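/- Let X be a finite metric space and K < ∞. If X is K-TSP-efficient, then (La(X), d_La) admits a weak C-biLipschitz embedding into an ℓ∞-product of n ℝ-trees, where n ∈ ℕ and C < ∞ depend only on K. -/

import Mathlib

open Metric Set
open scoped Classical ENNReal NNReal

noncomputable section

/-- The underlying set of the lamplighter space over `X`: a lamp configuration
(a finite set of lit lamps) together with the position of the lamplighter. -/
abbrev Lamp (X : Type*) := Finset X × X

namespace Lamplighter

variable {X Y Z : Type*}

/-- The length of the path visiting the points of a list in order,
with respect to the distance function `d`. -/
def pathLength (d : X → X → ℝ) : List X → ℝ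
  | [] => 0
  | [_] => 0
  | x :: y :: l => d x y + pathLength d (y :: l)

/-- The symmetric difference of the lamp configurations of `p` and `q`, as a set. -/
def sd (p q : Lamp X) : Set X :=
  ((p.1 : Set X) \ (q.1 : Set X)) ∪ ((q.1 : Set X) \ (p.1 : Set X))

/-- The traveling salesman semimetric on the lamplighter space:
the infimum of lengths of finite paths starting at `p.2`, ending at `q.2`, and
visiting every point of the symmetric difference of the configurations. -/
def TSP (d : X → X → ℝ) (p q : Lamp X) : ℝ :=
  sInf { s : ℝ | ∃ l : List X, l.head? = some p.2 ∧ l.getLast? = some q.2 ∧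
    (∀ a ∈ sd p q, a ∈ l) ∧ s = pathLength d l }

/-- The diameter (in `ℝ≥0∞`) of a set with respect to a distance function `d`. -/
def ediamD (d : X → X → ℝ) (A : Set X) : ℝ≥0∞ :=
  ⨆ x ∈ A, ⨆ y ∈ A, ENNReal.ofReal (d x y)

/-- The traveling salesman shortcut semimetric:
`TSCP((A,x),(B,y)) = diam({x,y} ∪ (A Δ B))`. -/
def TSCP (d : X → X → ℝ) (p q : Lamp X) : ℝ :=
  (ediamD d ({p.2, q.2} ∪ sd p q)).toReal

/-- `ρ((A,x),(B,y))` is `0` if `A = B` and `1` otherwise. -/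
def rho (p q : Lamp X) : ℝ := if p.1 = q.1 then 0 else 1

/-- The lamplighter metric `d_La = TSP + ρ`. -/
def dLa (d : X → X → ℝ) (p q : Lamp X) : ℝ := TSP d p q + rho p q

/-- `X` is `K`-TSP-efficient if `TSP ≤ K • TSCP` on `La(X)²`. -/
def TSPEfficient (d : X → X → ℝ) (K : ℝ) : Prop :=
  ∀ p q : Lamp X, TSP d p q ≤ K * TSCP d p q

/-- A weak `C`-biLipschitz embedding between spaces with distance functions `dY`, `dZ`:
a family of maps `φ t : Y → Z` (for `t > 0`) such that each `φ t` is `σ t`-Lipschitz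
and `dY x y ≥ C*t` implies `dZ (φ t x) (φ t y) ≥ t * σ t`. -/
def WeakBiLip (dY : Y → Y → ℝ) (dZ : Z → Z → ℝ) (C : ℝ) : Prop :=
  ∃ φ : ℝ → Y → Z, ∀ t : ℝ, 0 < t → ∃ σ : ℝ, 0 < σ ∧
    (∀ x y : Y, dZ (φ t x) (φ t y) ≤ σ * dY x y) ∧
    (∀ x y : Y, C * t ≤ dY x y → t * σ ≤ dZ (φ t x) (φ t y))

/-- `f` is a `C`-biLipschitz embedding (an injective map of biLipschitz
distortion at most `C`, allowing an overall scaling factor `s`). -/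
def BiLipWith (dY : Y → Y → ℝ) (dZ : Z → Z → ℝ) (C : ℝ) (f : Y → Z) : Prop :=
  Function.Injective f ∧ ∃ s : ℝ, 0 < s ∧
    ∀ x y : Y, s * dY x y ≤ dZ (f x) (f y) ∧ dZ (f x) (f y) ≤ C * s * dY x y

/-- Nagata dimension at most `n` with constant at most `γ`: for every scale `s > 0`
there is a covering by sets of diameter at most `γ s` such that every set of diameter
less than `s` meets at most `n + 1` members of the covering. -/
def NagataDimD (d : Y → Y → ℝ) (n : ℕ) (γ : ℝ) : Prop :=
  ∀ s : ℝ, 0 < s → ∃ B : Set (Set Y),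
    (∀ y : Y, ∃ b ∈ B, y ∈ b) ∧
    (∀ b ∈ B, ediamD d b ≤ ENNReal.ofReal (γ * s)) ∧
    (∀ A : Set Y, ediamD d A < ENNReal.ofReal s →
      {b | b ∈ B ∧ (b ∩ A).Nonempty}.encard ≤ ((n : ℕ∞) + 1))

/-- Markov type 2 with constant `M`, for the distance function `d`: for every stationary
reversible Markov chain on a finite state space (given by a stationary distribution `μ`
and a reversible stochastic transition matrix `P`), every map `f` into the space, and
every time `t`, `E[d(f(Z_t),f(Z_0))²] ≤ M² t E[d(f(Z_1),f(Z_0))²]`. -/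
def HasMarkovType2 (d : Y → Y → ℝ) (M : ℝ) : Prop :=
  ∀ (n : ℕ) (μ : Fin n → ℝ) (P : Matrix (Fin n) (Fin n) ℝ),
    (∀ i, 0 ≤ μ i) → (∑ i, μ i) = 1 →
    (∀ i j, 0 ≤ P i j) → (∀ i, (∑ j, P i j) = 1) →
    (∀ i j, μ i * P i j = μ j * P j i) →
    ∀ (f : Fin n → Y) (t : ℕ),
      (∑ i, ∑ j, μ i * (P ^ t) i j * d (f i) (f j) ^ 2) ≤
        M ^ 2 * t * ∑ i, ∑ j, μ i * P i j * d (f i) (f j) ^ 2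

/-- `D`-doubling: every ball of radius `r` can be covered by `D` balls of radius `r/2`. -/
def Doubling (d : Y → Y → ℝ) (D : ℕ) : Prop :=
  ∀ r : ℝ, 0 < r → ∀ x : Y, ∃ c : Fin D → Y,
    ∀ y : Y, d x y ≤ r → ∃ i, d (c i) y ≤ r / 2

/-- `A` is an arc from `x` to `y`: the image of an injective continuous map of `[0,1]`
sending the endpoints to `x` and `y`. -/
def IsArc {T : Type*} [MetricSpace T] (x y : T) (A : Set T) : Prop :=
  ∃ γ : ℝ → T, ContinuousOn γ (Icc 0 1) ∧ InjOn γ (Icc 0 1) ∧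
    γ 0 = x ∧ γ 1 = y ∧ γ '' (Icc 0 1) = A

/-- `A` is a geodesic segment from `x` to `y`: the image of an isometric embedding
of `[0, dist x y]` sending the endpoints to `x` and `y`. -/
def IsGeodesicSeg {T : Type*} [MetricSpace T] (x y : T) (A : Set T) : Prop :=
  ∃ γ : ℝ → T, γ 0 = x ∧ γ (dist x y) = y ∧
    (∀ s ∈ Icc (0 : ℝ) (dist x y), ∀ t ∈ Icc (0 : ℝ) (dist x y),
      dist (γ s) (γ t) = |s - t|) ∧
    γ '' (Icc 0 (dist x y)) = A

/-- `T` is an ℝ-tree: any two (distinct) points are joined by a unique arc,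
and this arc is a geodesic. -/
def IsRTree (T : Type*) [MetricSpace T] : Prop :=
  ∀ x y : T, x ≠ y →
    (∃ A : Set T, IsArc x y A) ∧
    (∀ A A' : Set T, IsArc x y A → IsArc x y A' → A = A') ∧
    (∀ A : Set T, IsArc x y A → IsGeodesicSeg x y A)

/-- The sup (ℓ∞-product) distance on a finite product of metric spaces. -/
def piSupDist {n : ℕ} {T : Fin n → Type*} (I : ∀ i, MetricSpace (T i)) :
    (∀ i, T i) → (∀ i, T i) → ℝ :=
  letI := I
  fun f g => dist f g

/-- The ℓ1-product distance on a finite product of metric spaces. -/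
def piL1Dist {n : ℕ} {T : Fin n → Type*} (I : ∀ i, MetricSpace (T i)) :
    (∀ i, T i) → (∀ i, T i) → ℝ :=
  letI := I
  fun f g => ∑ i, dist (f i) (g i)

/-- The ℓ1 distance on `ℝ^m`. -/
def l1Dist (m : ℕ) (x y : Fin m → ℝ) : ℝ := ∑ i, |x i - y i|

/-- The ℓp distance on `ℝ^m`. -/
def lpDist (m : ℕ) (p : ℝ) (x y : Fin m → ℝ) : ℝ :=
  (∑ i, |x i - y i| ^ p) ^ (1 / p)

/-- The (pseudo)distance of the ℝ-star over the index type `ι`: the wedge sum of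
copies of `[0,∞)` indexed by `ι`, glued at `0`. -/
def starDist {ι : Type*} (p q : ι × ℝ≥0) : ℝ :=
  if p.1 = q.1 then |(p.2 : ℝ) - (q.2 : ℝ)| else (p.2 : ℝ) + (q.2 : ℝ)

/-- The sup (ℓ∞-product) of finitely many distance functions. -/
def supD {n : ℕ} {T : Fin n → Type*} (d : ∀ i, T i → T i → ℝ) (f g : ∀ i, T i) : ℝ :=
  ((Finset.univ.sup fun i => (d i (f i) (g i)).toNNReal : ℝ≥0) : ℝ)

/-- The infimum of distortions of biLipschitz embeddings of `(Y, dY)` into `(Z, dZ)`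
(`∞` if there is no such embedding). -/
def cEmb (dY : Y → Y → ℝ) (dZ : Z → Z → ℝ) : ℝ≥0∞ :=
  sInf { D : ℝ≥0∞ | ∃ C : ℝ, 0 < C ∧ D = ENNReal.ofReal C ∧
    ∃ f : Y → Z, BiLipWith dY dZ C f }

/-- `c_1^{m,dom}(X,d)`: the infimum of all `D > 0` such that there exist injective
`1`-Lipschitz maps `φ i : X → ℝ` and weights `α i ≥ 0` summing to `1` with
`∑ i, α i * |φ i x - φ i y| ≥ d x y / D` for all `x y` (`∞` if there is none). -/
def c1dom (d : X → X → ℝ) (m : ℕ) : ℝ≥0∞ :=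
  sInf { D : ℝ≥0∞ | ∃ C : ℝ, 0 < C ∧ D = ENNReal.ofReal C ∧
    ∃ (φ : Fin m → X → ℝ) (α : Fin m → ℝ),
      (∀ i, Function.Injective (φ i)) ∧
      (∀ i, ∀ x y : X, |φ i x - φ i y| ≤ d x y) ∧
      (∀ i, 0 ≤ α i) ∧ (∑ i, α i) = 1 ∧
      ∀ x y : X, d x y / C ≤ ∑ i, α i * |φ i x - φ i y| }

/-- The Hamming distance on the Hamming cube `{0,1}^M`, as a real number. -/
def hamDist {M : ℕ} (x y : Fin M → Bool) : ℝ :=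
  ((Finset.univ.filter fun i => x i ≠ y i).card : ℝ)

/-- The star graph `St_{n,k}`: the one-point coalescence of `n` paths of length `k`,
realized inside `ℤ^n` as the multiples `α eᵢ` with `0 ≤ α ≤ k`. -/
def St (n k : ℕ) : Type :=
  {x : Fin n → ℤ // ∃ i : Fin n, (∀ j : Fin n, j ≠ i → x j = 0) ∧ 0 ≤ x i ∧ x i ≤ (k : ℤ)}

/-- The ℓ1 metric on the star graph `St_{n,k}`. -/
def stDist {n k : ℕ} (x y : St n k) : ℝ := ∑ j, |(x.1 j : ℝ) - (y.1 j : ℝ)|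

/-- The endpoint `k eᵢ` of the `i`-th branch of the star graph. -/
def St.endpoint {n k : ℕ} (i : Fin n) : St n k :=
  ⟨fun j => if j = i then (k : ℤ) else 0, i, fun j hj => if_neg hj, by simp, by simp⟩

/-- The cycle metric on `ℤ/nℤ`. -/
def cycDist {n : ℕ} (a b : ZMod n) : ℝ := ((min ((a - b).val) ((b - a).val) : ℕ) : ℝ)

/-- The rectangular grid `G_{k,n} = ([0,k] ∩ ℤ) × ([0,n] ∩ ℤ)`. -/
def Grid2 (k n : ℕ) : Type :=
  {p : ℤ × ℤ // 0 ≤ p.1 ∧ p.1 ≤ (k : ℤ) ∧ 0 ≤ p.2 ∧ p.2 ≤ (n : ℤ)}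

/-- The ℓ1 metric on the grid `G_{k,n}`. -/
def grid2Dist {k n : ℕ} (x y : Grid2 k n) : ℝ :=
  |(x.1.1 : ℝ) - (y.1.1 : ℝ)| + |(x.1.2 : ℝ) - (y.1.2 : ℝ)|

/-- The `m`-dimensional grid `G^m({n_i}) = ∏ i, ([0, n_i] ∩ ℤ)`. -/
def GridM (m : ℕ) (n : Fin m → ℕ) : Type :=
  {p : Fin m → ℤ // ∀ i, 0 ≤ p i ∧ p i ≤ (n i : ℤ)}

/-- The ℓ1 metric on the `m`-dimensional grid. -/
def gridMDist {m : ℕ} {n : Fin m → ℕ} (x y : GridM m n) : ℝ :=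
  ∑ i, |(x.1 i : ℝ) - (y.1 i : ℝ)|

/-! ### Path lengths and the traveling salesman semimetric -/

section PathLength

variable [MetricSpace X]

theorem pathLength_nonneg (l : List X) : 0 ≤ pathLength (dist : X → X → ℝ) l := by
  induction l with
  | nil => simp [pathLength]
  | cons x l ih =>
    cases l with
    | nil => simp [pathLength]
    | cons y l => simp only [pathLength]; have := dist_nonneg (x := x) (y := y); linarith

theorem dist_add_dist_le_pathLength {y : X} (l : List X) :
    ∀ x a : X, (x :: l).getLast? = some y → a ∈ x :: l →
      dist x a + dist a y ≤ pathLength (dist : X → X → ℝ) (x :: l) := by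
  induction l with
  | nil =>
    intro x a hy ha
    simp only [List.getLast?_singleton, Option.some.injEq] at hy
    simp only [List.mem_singleton] at ha
    subst hy ha
    simp [pathLength]
  | cons z l ih =>
    intro x a hy ha
    rw [List.getLast?_cons_cons] at hy
    simp only [pathLength]
    rcases List.mem_cons.1 ha with rfl | ha
    · have h := ih z z hy List.mem_cons_self
      rw [dist_self, zero_add] at h ⊢
      have := dist_triangle a z y
      linarith
    · have h := ih z a hy ha
      have := dist_triangle x z a
      linarith

/-- A path starting at `x` and visiting all points of a `t`-separated set `S`. -/
theorem exists_dist_add_card_le_pathLength {t : ℝ} (l : List X) :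
    ∀ (x : X) (S : Finset X), S.Nonempty → (∀ a ∈ S, a ∈ l) →
      (∀ a ∈ S, ∀ b ∈ S, a ≠ b → t ≤ dist a b) →
      ∃ s ∈ S, dist x s + ((S.card : ℝ) - 1) * t ≤ pathLength (dist : X → X → ℝ) (x :: l) := by
  induction l with
  | nil =>
    rintro x S ⟨a, ha⟩ hl
    exact absurd (hl a ha) (by simp)
  | cons y l ih =>
    intro x S hS hl hsep
    simp only [pathLength]
    by_cases hy : y ∈ S
    · refine ⟨y, hy, ?_⟩
      have hcard := Finset.card_erase_add_one hy
      have hcard' : (S.card : ℝ) = (S.erase y).card + 1 := by exact_mod_cast hcard.symm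
      rcases (S.erase y).eq_empty_or_nonempty with h0 | h0
      · rw [hcard', h0]
        have := pathLength_nonneg (y :: l)
        simpa using this
      · obtain ⟨s, hs, h⟩ := ih y (S.erase y) h0
          (fun a ha => (List.mem_cons.1 (hl a (Finset.mem_of_mem_erase ha))).resolve_left
            (Finset.ne_of_mem_erase ha))
          (fun a ha b hb => hsep a (Finset.mem_of_mem_erase ha) b (Finset.mem_of_mem_erase hb))
        have := hsep y hy s (Finset.mem_of_mem_erase hs) (Finset.ne_of_mem_erase hs).symm
        rw [hcard']
        linarith
    · obtain ⟨s, hs, h⟩ := ih y S hS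
        (fun a ha => (List.mem_cons.1 (hl a ha)).resolve_left fun h => hy (h ▸ ha)) hsep
      refine ⟨s, hs, ?_⟩
      have := dist_triangle x y s
      linarith

theorem TSCP_le {p q : Lamp X} {z : X} {r : ℝ} (hr : 0 ≤ r) (hp : dist p.2 z ≤ r)
    (hq : dist q.2 z ≤ r) (h : ∀ a ∈ sd p q, dist a z ≤ r) :
    TSCP (dist : X → X → ℝ) p q ≤ 2 * r := by
  have key : ∀ a ∈ ({p.2, q.2} ∪ sd p q : Set X), dist a z ≤ r := by
    rintro a ((rfl | rfl) | ha)
    exacts [hp, hq, h a ha]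
  refine ENNReal.toReal_le_of_le_ofReal (by linarith) ?_
  refine iSup₂_le fun a ha => iSup₂_le fun b hb => ENNReal.ofReal_le_ofReal ?_
  have := dist_triangle_right a b z
  linarith [key a ha, key b hb]

theorem TSPEfficient.mono {K K' : ℝ} (h : TSPEfficient (dist : X → X → ℝ) K) (hK : K ≤ K') :
    TSPEfficient (dist : X → X → ℝ) K' :=
  fun p q => (h p q).trans (mul_le_mul_of_nonneg_right hK ENNReal.toReal_nonneg)

variable [Fintype X]

theorem le_TSP {p q : Lamp X} {c : ℝ}
    (h : ∀ l : List X, (p.2 :: l).getLast? = some q.2 → (∀ a ∈ sd p q, a ∈ p.2 :: l) →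
      c ≤ pathLength (dist : X → X → ℝ) (p.2 :: l)) :
    c ≤ TSP (dist : X → X → ℝ) p q := by
  refine le_csInf ⟨_, p.2 :: (Finset.univ.toList ++ [q.2]), by simp, ?_, by simp, rfl⟩ ?_
  · rw [← List.cons_append, List.getLast?_append]
    simp
  · rintro s ⟨l, h1, h2, h3, rfl⟩
    cases l with
    | nil => simp at h1
    | cons x l =>
      simp only [List.head?_cons, Option.some.injEq] at h1
      subst h1
      exact h l h2 h3

theorem dist_le_TSP (p q : Lamp X) : dist p.2 q.2 ≤ TSP (dist : X → X → ℝ) p q :=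
  le_TSP fun l hl _ => by
    simpa using dist_add_dist_le_pathLength l p.2 _ hl List.mem_cons_self

theorem dist_add_dist_le_TSP {p q : Lamp X} {a : X} (ha : a ∈ sd p q) :
    dist p.2 a + dist a q.2 ≤ TSP (dist : X → X → ℝ) p q :=
  le_TSP fun l hl h => dist_add_dist_le_pathLength l p.2 _ hl (h a ha)

theorem TSP_nonneg (p q : Lamp X) : 0 ≤ TSP (dist : X → X → ℝ) p q :=
  dist_nonneg.trans (dist_le_TSP p q)

theorem card_sub_one_mul_le_TSP {t : ℝ} (S : Finset X) (x : X) (hS : S.Nonempty)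
    (hsep : ∀ a ∈ S, ∀ b ∈ S, a ≠ b → t ≤ dist a b) :
    ((S.card : ℝ) - 1) * t ≤ TSP (dist : X → X → ℝ) (S, x) (∅, x) := by
  refine le_TSP fun l _ hl => ?_
  obtain ⟨s, -, h⟩ := exists_dist_add_card_le_pathLength (x :: l) x S hS
    (fun a ha => hl a (by simp [sd, ha])) hsep
  have := dist_nonneg (x := x) (y := s)
  simp only [pathLength, dist_self, zero_add] at h
  linarith

end PathLength

/-! ### Nets and colorings -/

section Net

variable [MetricSpace X]

theorem exists_net {t : ℝ} (s : Finset X) :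
    ∃ N ⊆ s, (∀ x ∈ s, ∃ p ∈ N, dist x p ≤ t ∨ x = p) ∧
      ∀ p ∈ N, ∀ q ∈ N, p ≠ q → t ≤ dist p q := by
  induction s using Finset.induction_on with
  | empty => exact ⟨∅, by simp⟩
  | insert a s ha ih =>
    obtain ⟨N, hN, hcov, hsep⟩ := ih
    by_cases h : ∃ p ∈ N, dist a p ≤ t
    · refine ⟨N, hN.trans (Finset.subset_insert a s), ?_, hsep⟩
      intro x hx
      rcases Finset.mem_insert.1 hx with rfl | hx
      · obtain ⟨p, hp, hd⟩ := h
        exact ⟨p, hp, Or.inl hd⟩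
      · exact hcov x hx
    · push Not at h
      refine ⟨insert a N, Finset.insert_subset_insert a hN, ?_, ?_⟩
      · intro x hx
        rcases Finset.mem_insert.1 hx with rfl | hx
        · exact ⟨x, Finset.mem_insert_self x N, Or.inr rfl⟩
        · obtain ⟨p, hp, hd⟩ := hcov x hx
          exact ⟨p, Finset.mem_insert_of_mem hp, hd⟩
      · intro p hp q hq hpq
        rcases Finset.mem_insert.1 hp with rfl | hp' <;> rcases Finset.mem_insert.1 hq with rfl | hq'
        · exact absurd rfl hpq
        · exact (h q hq').le
        · rw [dist_comm]
          exact (h p hp').le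
        · exact hsep p hp' q hq' hpq

/-- Greedy coloring: a finite set whose points have fewer than `n` neighbors at distance less
than `R` can be colored with `n` colors such that points of equal color are `R`-separated. -/
theorem exists_coloring {n : ℕ} [NeZero n] {R : ℝ} (s : Finset X)
    (h : ∀ p ∈ s, (s.filter fun q => q ≠ p ∧ dist q p < R).card < n) :
    ∃ col : X → Fin n, ∀ p ∈ s, ∀ q ∈ s, col p = col q → p ≠ q → R ≤ dist p q := by
  induction s using Finset.induction_on with
  | empty => exact ⟨fun _ => 0, by simp⟩
  | insert a s ha ih =>
    obtain ⟨col, hcol⟩ := ih fun p hp =>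
      (Finset.card_le_card (Finset.filter_subset_filter _ (Finset.subset_insert a s))).trans_lt
        (h p (Finset.mem_insert_of_mem hp))
    obtain ⟨c, -, hc⟩ : ∃ c ∈ (Finset.univ : Finset (Fin n)),
        c ∉ ((insert a s).filter fun q => q ≠ a ∧ dist q a < R).image col :=
      Finset.exists_mem_notMem_of_card_lt_card <| by
        rw [Finset.card_fin]
        exact Finset.card_image_le.trans_lt (h a (Finset.mem_insert_self a s))
    have hsep : ∀ q ∈ s, col q = c → R ≤ dist q a := by
      intro q hq hqc
      by_contra! hlt
      exact hc (Finset.mem_image.2 ⟨q, Finset.mem_filter.2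
        ⟨Finset.mem_insert_of_mem hq, fun e => ha (e ▸ hq), hlt⟩, hqc⟩)
    refine ⟨Function.update col a c, fun p hp q hq hpq hne => ?_⟩
    rcases Finset.mem_insert.1 hp with rfl | hp' <;> rcases Finset.mem_insert.1 hq with rfl | hq'
    · exact absurd rfl hne
    · rw [Function.update_self, Function.update_of_ne hne.symm] at hpq
      rw [dist_comm]
      exact hsep q hq' hpq.symm
    · rw [Function.update_self, Function.update_of_ne hne] at hpq
      exact hsep p hp' hpq
    · rw [Function.update_of_ne (ne_of_mem_of_not_mem hp' ha),
        Function.update_of_ne (ne_of_mem_of_not_mem hq' ha)] at hpq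
      exact hcol p hp' q hq' hpq hne

theorem exists_colored_net [Fintype X] {K t : ℝ} (hX : TSPEfficient (dist : X → X → ℝ) K)
    (hK : 0 ≤ K) (ht : 0 < t) :
    ∃ (N : Finset X) (col : X → Fin (⌊8 * K⌋₊ + 1)), (∀ x, ∃ p ∈ N, dist x p ≤ t) ∧
      ∀ p ∈ N, ∀ q ∈ N, col p = col q → p ≠ q → 4 * t ≤ dist p q := by
  obtain ⟨N, -, hcov, hsep⟩ := exists_net (t := t) (Finset.univ : Finset X)
  obtain ⟨col, hcol⟩ := exists_coloring (n := ⌊8 * K⌋₊ + 1) (R := 4 * t) N (fun p hp => by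
    set S := N.filter fun q => q ≠ p ∧ dist q p < 4 * t with hS
    have hpS : p ∉ S := by simp [hS]
    have hmem : ∀ a ∈ insert p S, a ∈ N ∧ dist a p ≤ 4 * t := by
      intro a ha
      rcases Finset.mem_insert.1 ha with rfl | ha
      · exact ⟨hp, by rw [dist_self]; positivity⟩
      · have := Finset.mem_filter.1 ha
        exact ⟨this.1, this.2.2.le⟩
    have h1 := card_sub_one_mul_le_TSP (insert p S) p (Finset.insert_nonempty p S)
      fun a ha b hb => hsep a (hmem a ha).1 b (hmem b hb).1
    have h2 : TSCP (dist : X → X → ℝ) (insert p S, p) (∅, p) ≤ 2 * (4 * t) := by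
      refine TSCP_le (z := p) (by positivity) (by rw [dist_self]; positivity)
        (by rw [dist_self]; positivity) fun a ha => (hmem a ?_).2
      simpa [sd] using ha
    have h3 := hX (insert p S, p) (∅, p)
    have h4 := mul_le_mul_of_nonneg_left h2 hK
    rw [Finset.card_insert_of_notMem hpS] at h1
    push_cast at h1
    have h5 : (S.card : ℝ) * t ≤ 8 * K * t := by linarith
    exact Nat.lt_succ_of_le (Nat.le_floor (le_of_mul_le_mul_right h5 ht)))
  refine ⟨N, col, fun x => ?_, hcol⟩
  obtain ⟨p, hp, h | rfl⟩ := hcov x (Finset.mem_univ x)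
  · exact ⟨p, hp, h⟩
  · exact ⟨x, hp, by rw [dist_self]; exact ht.le⟩

end Net

/-! ### A criterion for ℝ-trees -/

theorem isPreconnected_subset_arc_eq {T : Type*} [MetricSpace T] {δ : ℝ → T} {G : Set T}
    (hc : ContinuousOn δ (Icc 0 1)) (hi : InjOn δ (Icc 0 1)) (hG : IsPreconnected G)
    (hsub : G ⊆ δ '' Icc 0 1) (h0 : δ 0 ∈ G) (h1 : δ 1 ∈ G) : G = δ '' Icc 0 1 := by
  refine hsub.antisymm ?_
  rintro _ ⟨s, hs, rfl⟩
  have hl : Icc 0 s ⊆ Icc (0 : ℝ) 1 := Icc_subset_Icc_right hs.2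
  have hr : Icc s 1 ⊆ Icc (0 : ℝ) 1 := Icc_subset_Icc_left hs.1
  obtain ⟨_, hz, ⟨a, ha, rfl⟩, b, hb, hab⟩ := isPreconnected_closed_iff.1 hG
    (δ '' Icc 0 s) (δ '' Icc s 1)
    (isCompact_Icc.image_of_continuousOn (hc.mono hl)).isClosed
    (isCompact_Icc.image_of_continuousOn (hc.mono hr)).isClosed
    (by rwa [← image_union, Icc_union_Icc_eq_Icc hs.1 hs.2])
    ⟨δ 0, h0, 0, ⟨le_rfl, hs.1⟩, rfl⟩ ⟨δ 1, h1, 1, ⟨hs.2, le_rfl⟩, rfl⟩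
  have hba := hi (hr hb) (hl ha) hab
  have : a = s := le_antisymm ha.2 (hba ▸ hb.1)
  rwa [this] at hz

/-- A metric space in which any two points are joined by a geodesic that is contained in every
path between these points is an ℝ-tree. -/
theorem isRTree_of_geodesics {T : Type*} [MetricSpace T]
    (h : ∀ x y : T, ∃ γ : ℝ → T, γ 0 = x ∧ γ (dist x y) = y ∧
      (∀ s ∈ Icc (0 : ℝ) (dist x y), ∀ t ∈ Icc (0 : ℝ) (dist x y),
        dist (γ s) (γ t) = |s - t|) ∧
      ∀ δ : ℝ → T, ContinuousOn δ (Icc 0 1) → δ 0 = x → δ 1 = y →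
        γ '' Icc 0 (dist x y) ⊆ δ '' Icc 0 1) :
    IsRTree T := by
  intro x y hxy
  obtain ⟨γ, h0, h1, hiso, hcut⟩ := h x y
  have hD : 0 < dist x y := dist_pos.2 hxy
  have hcont : ContinuousOn γ (Icc 0 (dist x y)) := by
    refine LipschitzOnWith.continuousOn (K := 1) (LipschitzOnWith.of_dist_le_mul ?_)
    intro s hs t ht
    rw [hiso s hs t ht, NNReal.coe_one, one_mul, Real.dist_eq]
  have huniq : ∀ A : Set T, IsArc x y A → γ '' Icc 0 (dist x y) = A := by
    rintro A ⟨δ, hc, hi, hδ0, hδ1, rfl⟩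
    exact isPreconnected_subset_arc_eq hc hi (isPreconnected_Icc.image γ hcont)
      (hcut δ hc hδ0 hδ1) ⟨0, ⟨le_rfl, hD.le⟩, by rw [h0, hδ0]⟩
      ⟨dist x y, ⟨hD.le, le_rfl⟩, by rw [h1, hδ1]⟩
  refine ⟨⟨γ '' Icc 0 (dist x y), fun s => γ (dist x y * s), ?_, ?_, ?_, ?_, ?_⟩,
    fun A A' hA hA' => (huniq A hA).symm.trans (huniq A' hA'),
    fun A hA => ⟨γ, h0, h1, hiso, huniq A hA⟩⟩
  · refine hcont.comp (by fun_prop) fun s hs => ⟨by have := hs.1; positivity, ?_⟩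
    exact mul_le_of_le_one_right hD.le hs.2
  · intro s hs t ht hst
    have h2 := hiso (dist x y * s) ⟨mul_nonneg hD.le hs.1, mul_le_of_le_one_right hD.le hs.2⟩
      (dist x y * t) ⟨mul_nonneg hD.le ht.1, mul_le_of_le_one_right hD.le ht.2⟩
    simp only at hst
    rw [hst, dist_self, eq_comm, abs_eq_zero, ← mul_sub, mul_eq_zero] at h2
    exact sub_eq_zero.1 (h2.resolve_left hD.ne')
  · simpa using h0
  · simpa using h1
  · rw [← image_image γ (fun s => dist x y * s), image_mul_left_Icc hD.le zero_le_one]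
    simp

/-! ### Stars -/

/-- The star with branches indexed by `ι`: the wedge sum of copies of `[0,∞)`, with
the common origin represented by the default index. -/
@[ext]
structure Star (ι : Type*) [Inhabited ι] where
  /-- the branch containing the point -/
  branch : ι
  /-- the distance of the point from the center -/
  depth : ℝ
  depth_nonneg : 0 ≤ depth
  branch_eq : depth = 0 → branch = default

namespace Star

variable {ι : Type*} [Inhabited ι]

instance : MetricSpace (Star ι) where
  dist p q := if p.branch = q.branch then |p.depth - q.depth| else p.depth + q.depth
  dist_self p := by simp
  dist_comm p q := by
    simp only [eq_comm (a := p.branch), abs_sub_comm p.depth, add_comm p.depth]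
  dist_triangle p q r := by
    have hp := p.depth_nonneg
    have hq := q.depth_nonneg
    have hr := r.depth_nonneg
    split_ifs <;> first
      | exact abs_sub_le _ _ _
      | (exfalso; simp_all; done)
      | (rcases abs_cases (p.depth - q.depth) with h | h <;>
          rcases abs_cases (q.depth - r.depth) with h' | h' <;>
          rcases abs_cases (p.depth - r.depth) with h'' | h'' <;> linarith)
  eq_of_dist_eq_zero {p q} h := by
    have hp := p.depth_nonneg
    have hq := q.depth_nonneg
    by_cases hb : p.branch = q.branch
    · simp only [hb, if_true] at h
      exact Star.ext hb (sub_eq_zero.1 (abs_eq_zero.1 h))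
    · simp only [hb, if_false] at h
      exact absurd ((p.branch_eq (by linarith)).trans (q.branch_eq (by linarith)).symm) hb

theorem dist_def (p q : Star ι) :
    dist p q = if p.branch = q.branch then |p.depth - q.depth| else p.depth + q.depth := rfl

/-- The point at distance `r` from the center on the branch `i`. -/
def mk' (i : ι) (r : ℝ) : Star ι :=
  if h : 0 < r then ⟨i, r, h.le, fun h0 => absurd h0 h.ne'⟩ else ⟨default, 0, le_rfl, fun _ => rfl⟩

theorem mk'_branch_depth (p : Star ι) : mk' p.branch p.depth = p := by
  rcases p.depth_nonneg.lt_or_eq with h | h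
  · simp [mk', h]
  · ext
    · simp [mk', ← h, p.branch_eq h.symm]
    · simp [mk', ← h]

theorem dist_mk' {i j : ι} {r s : ℝ} (hr : 0 ≤ r) (hs : 0 ≤ s) :
    dist (mk' i r) (mk' j s) = if i = j then |r - s| else r + s := by
  rcases hr.lt_or_eq with hr | rfl <;> rcases hs.lt_or_eq with hs | rfl
  · simp [dist_def, mk', hr, hs]
  · simp [dist_def, mk', hr, abs_of_pos hr]
  · simp [dist_def, mk', hs, abs_of_pos hs]
  · simp [mk']

/-- The signed distance from the center, positive exactly on the branch `i`. -/
def coord (i : ι) (p : Star ι) : ℝ := if p.branch = i then p.depth else -p.depth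

theorem coord_mk'_self {i : ι} {r : ℝ} (hr : 0 ≤ r) : coord i (mk' i r) = r := by
  rcases hr.lt_or_eq with hr | rfl
  · simp [coord, mk', hr]
  · simp [coord, mk']

theorem coord_mk'_of_ne {i j : ι} (hij : i ≠ j) {r : ℝ} (hr : 0 ≤ r) :
    coord i (mk' j r) = -r := by
  rcases hr.lt_or_eq with hr | rfl
  · simp [coord, mk', hr, hij.symm]
  · simp [coord, mk']

theorem eq_mk'_of_coord_eq {i : ι} {r : ℝ} (hr : 0 ≤ r) {p : Star ι} (h : coord i p = r) :
    p = mk' i r := by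
  unfold coord at h
  split_ifs at h with hb
  · rw [← hb, ← h, mk'_branch_depth]
  · have hp := p.depth_nonneg
    have h0 : p.depth = 0 := by linarith
    have hr0 : r = 0 := by linarith
    ext
    · simp [mk', hr0, p.branch_eq h0]
    · simp [mk', hr0, h0]

theorem continuous_coord (i : ι) : Continuous (coord i : Star ι → ℝ) := by
  refine LipschitzWith.continuous (K := 1) (LipschitzWith.of_dist_le_mul fun p q => ?_)
  have hp := p.depth_nonneg
  have hq := q.depth_nonneg
  rw [NNReal.coe_one, one_mul, Real.dist_eq, dist_def]
  unfold coord
  split_ifs <;> first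
    | exact le_rfl
    | (exfalso; simp_all; done)
    | (rcases abs_cases (p.depth - q.depth) with h | h <;> rw [abs_le] <;>
        constructor <;> linarith)

/-- A path passes through each point whose coordinate lies between those of its ends. -/
theorem mk'_mem_image {i : ι} {r : ℝ} (hr : 0 ≤ r) {δ : ℝ → Star ι}
    (hδ : ContinuousOn δ (Icc 0 1)) (h : r ∈ uIcc (coord i (δ 0)) (coord i (δ 1))) :
    mk' i r ∈ δ '' Icc 0 1 := by
  have hc : ContinuousOn (fun s => coord i (δ s)) (uIcc 0 1) := by
    rw [uIcc_of_le zero_le_one]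
    exact (continuous_coord i).comp_continuousOn hδ
  obtain ⟨s, hs, hsr⟩ := intermediate_value_uIcc hc h
  rw [uIcc_of_le zero_le_one] at hs
  exact ⟨s, hs, eq_mk'_of_coord_eq hr hsr⟩

theorem isRTree : IsRTree (Star ι) := by
  refine isRTree_of_geodesics fun x y => ?_
  obtain ⟨i, a, ha, rfl⟩ : ∃ i a, 0 ≤ a ∧ x = mk' i a :=
    ⟨_, _, x.depth_nonneg, (mk'_branch_depth x).symm⟩
  obtain ⟨j, b, hb, rfl⟩ : ∃ j b, 0 ≤ b ∧ y = mk' j b :=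
    ⟨_, _, y.depth_nonneg, (mk'_branch_depth y).symm⟩
  rw [dist_mk' ha hb]
  by_cases hij : i = j
  · subst hij
    rw [if_pos rfl]
    rcases le_total a b with hab | hab
    · rw [abs_sub_comm, abs_of_nonneg (sub_nonneg.2 hab)]
      refine ⟨fun s => mk' i (a + s), by simp, by simp, ?_, ?_⟩
      · intro s hs t ht
        rw [dist_mk' (add_nonneg ha hs.1) (add_nonneg ha ht.1), if_pos rfl]
        congr 1
        ring
      · rintro δ hδ h0 h1 _ ⟨s, hs, rfl⟩
        refine mk'_mem_image (add_nonneg ha hs.1) hδ ?_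
        rw [h0, h1, coord_mk'_self ha, coord_mk'_self hb]
        exact Icc_subset_uIcc ⟨by linarith [hs.1], by linarith [hs.2]⟩
    · rw [abs_of_nonneg (sub_nonneg.2 hab)]
      refine ⟨fun s => mk' i (a - s), by simp, by simp, ?_, ?_⟩
      · intro s hs t ht
        rw [dist_mk' (by linarith [hs.2]) (by linarith [ht.2]), if_pos rfl, abs_sub_comm]
        congr 1
        ring
      · rintro δ hδ h0 h1 _ ⟨s, hs, rfl⟩
        refine mk'_mem_image (by linarith [hs.2]) hδ ?_
        rw [h0, h1, coord_mk'_self ha, coord_mk'_self hb]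
        exact Icc_subset_uIcc' ⟨by linarith [hs.2], by linarith [hs.1]⟩
  · rw [if_neg hij]
    refine ⟨fun s => if s ≤ a then mk' i (a - s) else mk' j (s - a), by simp [ha], ?_, ?_, ?_⟩
    · rcases hb.lt_or_eq with hb | rfl
      · simp [hb]
      · simp [mk']
    · intro s hs t ht
      by_cases hsa : s ≤ a <;> by_cases hta : t ≤ a
      · simp only [if_pos hsa, if_pos hta]
        rw [dist_mk' (by linarith) (by linarith), if_pos rfl, abs_sub_comm]
        congr 1
        ring
      · simp only [if_pos hsa, if_neg hta]
        rw [dist_mk' (by linarith) (by linarith), if_neg hij, abs_of_nonpos (by linarith)]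
        ring
      · simp only [if_neg hsa, if_pos hta]
        rw [dist_mk' (by linarith) (by linarith), if_neg (Ne.symm hij),
          abs_of_nonneg (by linarith)]
        ring
      · simp only [if_neg hsa, if_neg hta]
        rw [dist_mk' (by linarith) (by linarith), if_pos rfl]
        congr 1
        ring
    · rintro δ hδ h0 h1 _ ⟨s, hs, rfl⟩
      by_cases hsa : s ≤ a
      · simp only [if_pos hsa]
        refine mk'_mem_image (by linarith) hδ ?_
        rw [h0, h1, coord_mk'_self ha, coord_mk'_of_ne hij hb]
        exact Icc_subset_uIcc' ⟨by linarith, by linarith [hs.1]⟩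
      · simp only [if_neg hsa]
        refine mk'_mem_image (by linarith) hδ ?_
        rw [h0, h1, coord_mk'_self hb, coord_mk'_of_ne (Ne.symm hij) ha]
        exact Icc_subset_uIcc ⟨by linarith, by linarith [hs.2]⟩

end Star

/-! ### Maps from the lamplighter space to stars -/

section StarMap

variable [MetricSpace X]

/-- The part of a lamp configuration recorded at scale `t` by a lamplighter close to `p`. -/
def visibleLamps (t : ℝ) (p : X) (A : Finset X) : Finset X :=
  if t ≤ 1 / 4 then A else A.filter fun a => 2 * t ≤ dist a p

/-- The map from the lamplighter space to a star given by the set of centers `N`, at scale `t`. -/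
def starMap (N : Finset X) (t : ℝ) (u : Lamp X) : Star (Option (X × Finset X)) :=
  if h : ∃ p ∈ N, dist u.2 p < 2 * t then
    Star.mk' (some (h.choose, visibleLamps t h.choose u.1)) (2 * t - dist u.2 h.choose)
  else Star.mk' none 0

theorem starMap_of_forall {N : Finset X} {t : ℝ} {u : Lamp X}
    (h : ∀ p ∈ N, 2 * t ≤ dist u.2 p) : starMap N t u = Star.mk' none 0 := by
  rw [starMap, dif_neg]
  push Not
  exact h

theorem starMap_of_mem {N : Finset X} {t : ℝ} {u : Lamp X} {p : X} (hp : p ∈ N)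
    (hN : ∀ p ∈ N, ∀ q ∈ N, p ≠ q → 4 * t ≤ dist p q) (h : dist u.2 p < 2 * t) :
    starMap N t u = Star.mk' (some (p, visibleLamps t p u.1)) (2 * t - dist u.2 p) := by
  have hex : ∃ p ∈ N, dist u.2 p < 2 * t := ⟨p, hp, h⟩
  have heq : hex.choose = p := by
    by_contra hne
    have h1 := hN _ hex.choose_spec.1 p hp hne
    have h2 := hex.choose_spec.2
    have := dist_triangle_left hex.choose p u.2
    linarith
  rw [starMap, dif_pos hex, heq]

theorem eq_of_visibleLamps_eq {t : ℝ} {p : X} {A B : Finset X} (ht : t ≤ 1 / 4)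
    (h : visibleLamps t p A = visibleLamps t p B) : A = B := by
  simpa only [visibleLamps, if_pos ht] using h

theorem dist_lt_of_visibleLamps_eq {t : ℝ} {p : X} {u v : Lamp X}
    (h : visibleLamps t p u.1 = visibleLamps t p v.1) : ∀ a ∈ sd u v, dist a p < 2 * t := by
  intro a ha
  unfold visibleLamps at h
  split_ifs at h
  · simp [sd, h] at ha
  · have h' := Finset.ext_iff.1 h a
    simp only [Finset.mem_filter] at h'
    by_contra! hlt
    simp only [sd, mem_union, mem_sdiff, Finset.mem_coe] at ha
    tauto

theorem exists_mem_sd_of_visibleLamps_ne {t : ℝ} {p : X} {u v : Lamp X} (ht : ¬ t ≤ 1 / 4)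
    (h : visibleLamps t p u.1 ≠ visibleLamps t p v.1) : ∃ a ∈ sd u v, 2 * t ≤ dist a p := by
  by_contra! hcon
  refine h ?_
  simp only [visibleLamps, if_neg ht]
  ext a
  simp only [Finset.mem_filter, and_congr_left_iff]
  intro ha
  by_contra hne
  refine absurd (hcon a ?_) ha.not_gt
  simp only [sd, mem_union, mem_sdiff, Finset.mem_coe]
  tauto

theorem TSP_le_dLa (u v : Lamp X) :
    TSP (dist : X → X → ℝ) u v ≤ dLa (dist : X → X → ℝ) u v := by
  unfold dLa rho
  split_ifs <;> linarith

theorem dLa_le_of_dist_starMap_lt {N : Finset X} {K t : ℝ} (ht : 0 < t) (hK : 0 ≤ K)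
    (hX : TSPEfficient (dist : X → X → ℝ) K)
    (hN : ∀ p ∈ N, ∀ q ∈ N, p ≠ q → 4 * t ≤ dist p q) {u v : Lamp X} {p : X} (hp : p ∈ N)
    (hup : dist u.2 p ≤ t) (h : dist (starMap N t u) (starMap N t v) < t) :
    dLa (dist : X → X → ℝ) u v ≤ (4 * K + 4) * t := by
  rw [starMap_of_mem hp hN (by linarith)] at h
  by_cases hv : ∃ q ∈ N, dist v.2 q < 2 * t
  · obtain ⟨q, hq, hvq⟩ := hv
    rw [starMap_of_mem hq hN hvq, Star.dist_mk' (by linarith) (by linarith)] at h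
    split_ifs at h with hb
    · simp only [Option.some.injEq, Prod.mk.injEq] at hb
      obtain ⟨rfl, hb⟩ := hb
      have h1 : TSCP (dist : X → X → ℝ) u v ≤ 2 * (2 * t) :=
        TSCP_le (z := p) (by positivity) (by linarith) hvq.le
          fun a ha => (dist_lt_of_visibleLamps_eq hb a ha).le
      have h2 := hX u v
      have h3 := mul_le_mul_of_nonneg_left h1 hK
      have h4 : rho u v ≤ 4 * t := by
        unfold rho
        split_ifs with hlamp
        · positivity
        · by_contra! h5
          exact hlamp (eq_of_visibleLamps_eq (by linarith) hb)
      unfold dLa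
      linarith
    · linarith
  · push Not at hv
    rw [starMap_of_forall hv, Star.dist_mk' (by linarith) le_rfl, if_neg (by simp)] at h
    linarith

variable [Fintype X]

theorem dist_starMap_le {N : Finset X} {t : ℝ}
    (hN : ∀ p ∈ N, ∀ q ∈ N, p ≠ q → 4 * t ≤ dist p q) (u v : Lamp X) :
    dist (starMap N t u) (starMap N t v) ≤ dLa (dist : X → X → ℝ) u v := by
  have hTSP := TSP_le_dLa u v
  have hd := dist_le_TSP u v
  by_cases hu : ∃ p ∈ N, dist u.2 p < 2 * t <;> by_cases hv : ∃ p ∈ N, dist v.2 p < 2 * t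
  · obtain ⟨p, hp, hup⟩ := hu
    obtain ⟨q, hq, hvq⟩ := hv
    rw [starMap_of_mem hp hN hup, starMap_of_mem hq hN hvq,
      Star.dist_mk' (by linarith) (by linarith)]
    split_ifs with h
    · obtain rfl : p = q := by simp_all
      have h1 := abs_dist_sub_le v.2 u.2 p
      rw [dist_comm v.2 u.2] at h1
      have h2 : 2 * t - dist u.2 p - (2 * t - dist v.2 p) = dist v.2 p - dist u.2 p := by ring
      rw [h2]
      linarith
    · by_cases hpq : p = q
      · subst hpq
        have hne : visibleLamps t p u.1 ≠ visibleLamps t p v.1 := fun e => h (by rw [e])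
        have hu0 := dist_nonneg (x := u.2) (y := p)
        have hv0 := dist_nonneg (x := v.2) (y := p)
        by_cases ht : t ≤ 1 / 4
        · have hne' : u.1 ≠ v.1 := fun e => hne (by rw [e])
          have h0 := TSP_nonneg u v
          simp only [dLa, rho, if_neg hne']
          linarith
        · obtain ⟨a, ha, hap⟩ := exists_mem_sd_of_visibleLamps_ne ht hne
          have h1 := dist_add_dist_le_TSP ha
          have h2 := dist_triangle_left a p u.2
          have h3 := dist_triangle a v.2 p
          linarith
      · have h1 := hN p hp q hq hpq
        have h2 := dist_triangle_left p q u.2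
        have h3 := dist_triangle u.2 v.2 q
        linarith
  · obtain ⟨p, hp, hup⟩ := hu
    push Not at hv
    rw [starMap_of_mem hp hN hup, starMap_of_forall hv, Star.dist_mk' (by linarith) le_rfl,
      if_neg (by simp)]
    have h1 := hv p hp
    have h2 := dist_triangle_left v.2 p u.2
    linarith
  · obtain ⟨p, hp, hvp⟩ := hv
    push Not at hu
    rw [starMap_of_mem hp hN hvp, starMap_of_forall hu, Star.dist_mk' le_rfl (by linarith),
      if_neg (by simp)]
    have h1 := hu p hp
    have h2 := dist_triangle u.2 v.2 p
    linarith
  · push Not at hu hv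
    rw [starMap_of_forall hu, starMap_of_forall hv, dist_self]
    linarith [dist_nonneg (x := u.2) (y := v.2)]

end StarMap

/-- If a finite metric space `X` is `K`-TSP-efficient, then
`(La(X), d_La)` admits a weak `C`-biLipschitz embedding into an ℓ∞-product of `n`
ℝ-trees, where `n` and `C` depend only on `K`. -/
theorem statement8 (K : ℝ) :
    ∃ (n : ℕ) (C : ℝ), 0 < C ∧
      ∀ (X : Type u) [MetricSpace X] [Fintype X],
        TSPEfficient (dist : X → X → ℝ) K →
        ∃ (T : Fin n → Type u) (I : ∀ i, MetricSpace (T i)),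
          (∀ i, @IsRTree (T i) (I i)) ∧
          WeakBiLip (dLa (dist : X → X → ℝ)) (piSupDist I) C := by
  have hK : (0 : ℝ) ≤ max K 0 := le_max_right K 0
  refine ⟨⌊8 * max K 0⌋₊ + 1, 4 * max K 0 + 5, by positivity, ?_⟩
  intro X _ _ hX
  replace hX := hX.mono (le_max_left K 0)
  refine ⟨fun _ => Star (Option (X × Finset X)), fun _ => inferInstance,
    fun _ => Star.isRTree, ?_⟩
  choose N col hcov hcol using fun t : {t : ℝ // 0 < t} => exists_colored_net hX hK t.2
  refine ⟨fun t u c => if ht : 0 < t then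
    starMap ((N ⟨t, ht⟩).filter fun p => col ⟨t, ht⟩ p = c) t u else Star.mk' none 0, ?_⟩
  intro t ht
  have hsep : ∀ c, ∀ p ∈ (N ⟨t, ht⟩).filter (fun p => col ⟨t, ht⟩ p = c),
      ∀ q ∈ (N ⟨t, ht⟩).filter (fun p => col ⟨t, ht⟩ p = c), p ≠ q → 4 * t ≤ dist p q := by
    intro c p hp q hq hpq
    rw [Finset.mem_filter] at hp hq
    exact hcol ⟨t, ht⟩ p hp.1 q hq.1 (hp.2.trans hq.2.symm) hpq
  refine ⟨1, one_pos, fun u v => ?_, fun u v huv => ?_⟩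
  · simp only [dif_pos ht, one_mul, piSupDist]
    refine (dist_pi_le_iff ?_).2 fun c => dist_starMap_le (hsep c) u v
    exact (TSP_nonneg u v).trans (TSP_le_dLa u v)
  · simp only [dif_pos ht, mul_one, piSupDist]
    obtain ⟨p, hp, hup⟩ := hcov ⟨t, ht⟩ u.2
    by_contra! hlt
    have h := dLa_le_of_dist_starMap_lt ht hK hX (hsep (col ⟨t, ht⟩ p))
      (Finset.mem_filter.2 ⟨hp, rfl⟩) hup
      ((dist_le_pi_dist _ _ (col ⟨t, ht⟩ p)).trans_lt hlt)
    linarith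

end Lamplighter
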